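/- arXiv:2505.23972 — 3 statements merged into one kernel-verified Lean document; each statement's English description precedes it below -/
import Mathlib

section
/- Let α > 1, f ∈ SR_α, b < α and k ∈ SR_b. Then there exist z₀ ≥ 1 and r₀ > 0 such that: (a) for every Λ > r₀ there is exactly one y > z₀ with y·f′(y) − f(y) + k(y) = ln Λ; denote this unique value by g(Λ); (b) g ∈ SR₀ (g is smoothly regularly varying of index 0), and (c) the function h(u) := g(eᵘ), defined for u > ln r₀, belongs to SR_{1/α}. -/
open MeasureTheory Filter Real Set
open scoped Topology BigOperators ENNReal

noncomputable section

/-- `f` is smoothly regularly varying of index `α`: beyond some `z₀ ≥ 1` it is positive and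
infinitely differentiable, and `h u = log (f (exp u))` satisfies `h' → α` and
`h^(m) → 0` for every `m ≥ 2`. -/
def SmoothRegVary (α : ℝ) (f : ℝ → ℝ) : Prop :=
  ∃ z₀ : ℝ, 1 ≤ z₀ ∧ (∀ x, z₀ < x → 0 < f x) ∧
    ContDiffOn ℝ (⊤ : ℕ∞) f (Set.Ioi z₀) ∧
    Filter.Tendsto (deriv (fun u => Real.log (f (Real.exp u)))) Filter.atTop (nhds α) ∧
    ∀ m : ℕ, 2 ≤ m →
      Filter.Tendsto (iteratedDeriv m (fun u => Real.log (f (Real.exp u))))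
        Filter.atTop (nhds 0)

/-- `φ` tends to `c` at infinity, is eventually `n` times differentiable, and its derivatives of
orders `1, …, n` tend to `0`. -/
def FlatAtTop : ℕ → ℝ → (ℝ → ℝ) → Prop
  | 0, c, φ => Tendsto φ atTop (𝓝 c)
  | n + 1, c, φ => Tendsto φ atTop (𝓝 c) ∧ (∀ᶠ u in atTop, DifferentiableAt ℝ φ u) ∧
      FlatAtTop n 0 (deriv φ)

theorem Filter.EventuallyEq.deriv_atTop {φ ψ : ℝ → ℝ} (h : φ =ᶠ[atTop] ψ) :
    deriv φ =ᶠ[atTop] deriv ψ := by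
  obtain ⟨a, ha⟩ := eventually_atTop.1 h
  filter_upwards [eventually_gt_atTop a] with u hu
  refine Filter.EventuallyEq.deriv_eq ?_
  filter_upwards [Ioi_mem_nhds hu] with v hv using ha v (le_of_lt hv)

namespace FlatAtTop

theorem tendsto {n : ℕ} {c : ℝ} {φ : ℝ → ℝ} (h : FlatAtTop n c φ) :
    Tendsto φ atTop (𝓝 c) := by
  cases n with
  | zero => exact h
  | succ n => exact h.1

theorem congr {n : ℕ} {c : ℝ} {φ ψ : ℝ → ℝ} (h : FlatAtTop n c φ) (e : φ =ᶠ[atTop] ψ) :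
    FlatAtTop n c ψ := by
  induction n generalizing c φ ψ with
  | zero => exact Tendsto.congr' e h
  | succ n ih =>
    refine ⟨h.1.congr' e, ?_, ih h.2.2 e.deriv_atTop⟩
    obtain ⟨a, ha⟩ := eventually_atTop.1 e
    filter_upwards [eventually_gt_atTop a, h.2.1] with u hu hd
    refine hd.congr_of_eventuallyEq ?_
    filter_upwards [Ioi_mem_nhds hu] with v hv using (ha v (le_of_lt hv)).symm

theorem of_hasDerivAt {n : ℕ} {c : ℝ} {φ ψ : ℝ → ℝ} (h : Tendsto φ atTop (𝓝 c))
    (hd : ∀ᶠ u in atTop, HasDerivAt φ (ψ u) u) (hψ : FlatAtTop n 0 ψ) :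
    FlatAtTop (n + 1) c φ :=
  ⟨h, hd.mono fun _ hu => hu.differentiableAt, hψ.congr (hd.mono fun _ hu => hu.deriv.symm)⟩

theorem hasDerivAt {n : ℕ} {c : ℝ} {φ : ℝ → ℝ} (h : FlatAtTop (n + 1) c φ) :
    ∀ᶠ u in atTop, HasDerivAt φ (deriv φ u) u :=
  h.2.1.mono fun _ hu => hu.hasDerivAt

theorem pred {n : ℕ} {c : ℝ} {φ : ℝ → ℝ} (h : FlatAtTop (n + 1) c φ) : FlatAtTop n c φ := by
  induction n generalizing c φ with
  | zero => exact h.1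
  | succ n ih => exact ⟨h.1, h.2.1, ih h.2.2⟩

theorem const (n : ℕ) (c : ℝ) : FlatAtTop n c fun _ => c := by
  induction n generalizing c with
  | zero => exact tendsto_const_nhds
  | succ n ih =>
    exact of_hasDerivAt tendsto_const_nhds (.of_forall fun u => hasDerivAt_const u c) (ih 0)

theorem add {n : ℕ} {c d : ℝ} {φ ψ : ℝ → ℝ} (hφ : FlatAtTop n c φ) (hψ : FlatAtTop n d ψ) :
    FlatAtTop n (c + d) fun u => φ u + ψ u := by
  induction n generalizing c d φ ψ with
  | zero => exact Tendsto.add hφ hψ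
  | succ n ih =>
    refine of_hasDerivAt (hφ.1.add hψ.1) ?_ (by simpa using ih hφ.2.2 hψ.2.2)
    filter_upwards [hφ.hasDerivAt, hψ.hasDerivAt] with u h₁ h₂ using h₁.add h₂

theorem mul {n : ℕ} {c d : ℝ} {φ ψ : ℝ → ℝ} (hφ : FlatAtTop n c φ) (hψ : FlatAtTop n d ψ) :
    FlatAtTop n (c * d) fun u => φ u * ψ u := by
  induction n generalizing c d φ ψ with
  | zero => exact Tendsto.mul hφ hψ
  | succ n ih =>
    refine of_hasDerivAt (hφ.1.mul hψ.1) ?_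
      (by simpa using (ih hφ.2.2 hψ.pred).add (ih hφ.pred hψ.2.2))
    filter_upwards [hφ.hasDerivAt, hψ.hasDerivAt] with u h₁ h₂ using h₁.mul h₂

theorem neg {n : ℕ} {c : ℝ} {φ : ℝ → ℝ} (hφ : FlatAtTop n c φ) :
    FlatAtTop n (-c) fun u => -φ u := by
  simpa using (const n (-1)).mul hφ

theorem inv {n : ℕ} {c : ℝ} {φ : ℝ → ℝ} (hφ : FlatAtTop n c φ) (hc : c ≠ 0) :
    FlatAtTop n c⁻¹ fun u => (φ u)⁻¹ := by
  induction n with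
  | zero => exact Tendsto.inv₀ hφ hc
  | succ n ih =>
    refine of_hasDerivAt (hφ.1.inv₀ hc) (ψ := fun u => -deriv φ u * ((φ u)⁻¹ * (φ u)⁻¹)) ?_
      (by simpa using hφ.2.2.neg.mul ((ih hφ.pred).mul (ih hφ.pred)))
    filter_upwards [hφ.hasDerivAt, hφ.1.eventually_ne hc] with u h₁ h₂
    refine (h₁.fun_inv h₂).congr_deriv ?_
    rw [div_eq_mul_inv, sq, mul_inv]

theorem inv_id (n : ℕ) : FlatAtTop n 0 fun u => u⁻¹ := by
  induction n with
  | zero => exact tendsto_inv_atTop_zero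
  | succ n ih =>
    refine of_hasDerivAt tendsto_inv_atTop_zero (ψ := fun u => -(u⁻¹ * u⁻¹)) ?_
      (by simpa using (ih.mul ih).neg)
    filter_upwards [eventually_ne_atTop 0] with u hu
    refine (hasDerivAt_inv hu).congr_deriv ?_
    rw [sq, mul_inv]

theorem exp_of_tendsto_atBot {d : ℝ} {φ : ℝ → ℝ} (h : Tendsto φ atTop atBot)
    (hd : ∀ᶠ u in atTop, DifferentiableAt ℝ φ u) (hφ : ∀ n, FlatAtTop n d (deriv φ)) (n : ℕ) :
    FlatAtTop n 0 fun u => Real.exp (φ u) := by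
  induction n with
  | zero => exact Real.tendsto_exp_atBot.comp h
  | succ n ih =>
    refine of_hasDerivAt (Real.tendsto_exp_atBot.comp h) ?_ (by simpa using ih.mul (hφ n))
    filter_upwards [hd] with u hu using hu.hasDerivAt.exp

/-- Flatness is preserved by composition with `σ → ∞` solving `σ' = ρ` with `ρ` flat. -/
theorem comp {r : ℝ} {σ ρ : ℝ → ℝ} {n : ℕ} (hσ : Tendsto σ atTop atTop)
    (hd : ∀ᶠ u in atTop, HasDerivAt σ (ρ u) u) (hρ : ∀ m < n, FlatAtTop m r ρ)
    {c : ℝ} {φ : ℝ → ℝ} (hφ : FlatAtTop n c φ) :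
    FlatAtTop n c fun u => φ (σ u) := by
  induction n generalizing c φ with
  | zero => exact Tendsto.comp hφ hσ
  | succ n ih =>
    have := (ih (fun m hm => hρ m (hm.trans n.lt_succ_self)) hφ.2.2).mul (hρ n n.lt_succ_self)
    refine of_hasDerivAt (hφ.1.comp hσ) ?_ (by simpa using this)
    filter_upwards [hd, hσ.eventually hφ.hasDerivAt] with u h₁ h₂ using h₂.comp u h₁

/-- Flatness of `φ ∘ σ` when `σ → ∞` solves the autonomous equation `σ' = ρ ∘ σ`. -/
theorem comp_autonomous {r : ℝ} {σ ρ : ℝ → ℝ} (hσ : Tendsto σ atTop atTop)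
    (hd : ∀ᶠ u in atTop, HasDerivAt σ (ρ (σ u)) u) (hρ : ∀ n, FlatAtTop n r ρ)
    {n : ℕ} {c : ℝ} {φ : ℝ → ℝ} (hφ : FlatAtTop n c φ) :
    FlatAtTop n c fun u => φ (σ u) := by
  induction n using Nat.strong_induction_on generalizing c φ with
  | _ n ih => exact hφ.comp hσ hd fun m hm => ih m hm (hρ m)

theorem tendsto_iteratedDeriv {n : ℕ} {c : ℝ} {φ : ℝ → ℝ} (h : FlatAtTop (n + 1) c φ) :
    Tendsto (iteratedDeriv (n + 1) φ) atTop (𝓝 0) := by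
  induction n generalizing c φ with
  | zero => simpa [iteratedDeriv_one] using h.2.2.tendsto
  | succ n ih =>
    rw [iteratedDeriv_succ']
    exact ih h.2.2

theorem of_contDiffOn {a c : ℝ} {φ : ℝ → ℝ} (hs : ContDiffOn ℝ (⊤ : ℕ∞) φ (Ioi a))
    (h : Tendsto φ atTop (𝓝 c))
    (hm : ∀ m, 1 ≤ m → Tendsto (iteratedDeriv m φ) atTop (𝓝 0)) (n : ℕ) :
    FlatAtTop n c φ := by
  induction n generalizing c φ with
  | zero => exact h
  | succ n ih =>
    refine ⟨h, ?_, ih (hs.deriv_of_isOpen isOpen_Ioi (by simp)) ?_ fun m _ => ?_⟩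
    · filter_upwards [Ioi_mem_atTop a] with u hu
      exact (hs.differentiableOn (by simp)).differentiableAt (Ioi_mem_nhds hu)
    · simpa [iteratedDeriv_one] using hm 1 le_rfl
    · simpa [iteratedDeriv_succ'] using hm (m + 1) (by omega)

end FlatAtTop

theorem tendsto_atTop_of_tendsto_deriv {c : ℝ} (hc : 0 < c) {φ : ℝ → ℝ}
    (hd : ∀ᶠ u in atTop, DifferentiableAt ℝ φ u) (h : Tendsto (deriv φ) atTop (𝓝 c)) :
    Tendsto φ atTop atTop := by
  obtain ⟨a, ha⟩ := eventually_atTop.1 (hd.and (h.eventually_const_lt (half_lt_self hc)))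
  have key : ∀ u ≥ a, c / 2 * (u - a) + φ a ≤ φ u := fun u hu => by
    have := (convex_Ici a).mul_sub_le_image_sub_of_le_deriv
      (fun v hv => (ha v hv).1.continuousAt.continuousWithinAt)
      (fun v hv => (ha v (interior_subset hv)).1.differentiableWithinAt)
      (fun v hv => (ha v (interior_subset hv)).2.le) a self_mem_Ici u hu hu
    linarith
  refine tendsto_atTop_mono' _ (eventually_atTop.2 ⟨a, key⟩) ?_
  exact tendsto_atTop_add_const_right _ _
    ((tendsto_atTop_add_const_right _ (-a) tendsto_id).const_mul_atTop (half_pos hc))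

theorem SmoothRegVary.of_log_comp_exp {α z : ℝ} {f φ : ℝ → ℝ} (hz : 1 ≤ z)
    (hpos : ∀ x, z < x → 0 < f x) (hs : ContDiffOn ℝ (⊤ : ℕ∞) f (Ioi z))
    (hφ : ∀ u, Real.log (f (Real.exp u)) = φ u) (hflat : ∀ n, FlatAtTop n α (deriv φ)) :
    SmoothRegVary α f := by
  refine ⟨z, hz, hpos, hs, ?_⟩
  simp only [hφ]
  refine ⟨(hflat 0).tendsto, fun m hm => ?_⟩
  obtain ⟨m, rfl⟩ := Nat.exists_eq_add_of_le' hm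
  rw [iteratedDeriv_succ']
  exact (hflat _).tendsto_iteratedDeriv

theorem SmoothRegVary.exists_log_comp_exp {α : ℝ} {f : ℝ → ℝ} (hf : SmoothRegVary α f) :
    ∃ (a : ℝ) (φ : ℝ → ℝ), ContDiffOn ℝ (⊤ : ℕ∞) φ (Ioi a) ∧
      (∀ n, FlatAtTop n α (deriv φ)) ∧ (∀ u, a < u → f (Real.exp u) = Real.exp (φ u)) ∧
      ∀ u, a < u → Real.exp u * deriv f (Real.exp u) = deriv φ u * Real.exp (φ u) := by
  obtain ⟨z, hz, hpos, hs, h₁, h₂⟩ := hf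
  have hexp : ∀ u, Real.log z < u → z < Real.exp u := fun u hu =>
    (Real.log_lt_iff_lt_exp (by linarith)).1 hu
  have hφ : ContDiffOn ℝ (⊤ : ℕ∞) (fun u => Real.log (f (Real.exp u))) (Ioi (Real.log z)) :=
    (hs.comp Real.contDiff_exp.contDiffOn hexp).log fun u hu => (hpos _ (hexp u hu)).ne'
  refine ⟨Real.log z, _, hφ, ?_, fun u hu => (Real.exp_log (hpos _ (hexp u hu))).symm,
    fun u hu => ?_⟩
  · refine .of_contDiffOn (hφ.deriv_of_isOpen isOpen_Ioi (by simp)) h₁ fun m hm => ?_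
    rw [← iteratedDeriv_succ']
    exact h₂ _ (by omega)
  · have hfd : HasDerivAt f (deriv f (Real.exp u)) (Real.exp u) :=
      ((hs.differentiableOn (by simp)).differentiableAt
        (Ioi_mem_nhds (hexp u hu))).hasDerivAt
    have hp := hpos _ (hexp u hu)
    have := ((hfd.comp u (Real.hasDerivAt_exp u)).log hp.ne').deriv
    simp only [Function.comp_def] at this
    rw [this, Real.exp_log hp]
    field_simp

/-- Smooth inverse of a function with positive derivative tending to infinity. -/
theorem exists_smooth_inverse {a : ℝ} {φ : ℝ → ℝ} (hs : ContDiffOn ℝ (⊤ : ℕ∞) φ (Ici a))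
    (hpos : ∀ u, a < u → 0 < deriv φ u) (hφ : Tendsto φ atTop atTop) :
    ∃ ψ : ℝ → ℝ, (∀ v, φ a < v → a < ψ v ∧ φ (ψ v) = v) ∧ (∀ u, a < u → ψ (φ u) = u) ∧
      Tendsto ψ atTop atTop ∧ (∀ v, φ a < v → HasDerivAt ψ (deriv φ (ψ v))⁻¹ v) ∧
      ContDiffOn ℝ (⊤ : ℕ∞) ψ (Ioi (φ a)) := by
  have hmono : StrictMonoOn φ (Ici a) :=
    strictMonoOn_of_deriv_pos (convex_Ici a) hs.continuousOn (by simpa using hpos)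
  have hex : ∀ v, φ a < v → ∃ u, a < u ∧ φ u = v := fun v hv => by
    obtain ⟨w, hw, haw⟩ := ((hφ.eventually_gt_atTop v).and (eventually_gt_atTop a)).exists
    obtain ⟨u, hu, rfl⟩ := intermediate_value_Ioo haw.le
      (hs.continuousOn.mono Icc_subset_Ici_self) ⟨hv, hw⟩
    exact ⟨u, hu.1, rfl⟩
  choose! ψ hψ using hex
  have hlt : ∀ u, a < u → φ a < φ u := fun u hu => hmono self_mem_Ici hu.le hu
  have hleft : ∀ u, a < u → ψ (φ u) = u := fun u hu =>
    hmono.injOn (hψ _ (hlt u hu)).1.le hu.le (hψ _ (hlt u hu)).2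
  have hψmono : StrictMonoOn ψ (Ioi (φ a)) := fun v hv w hw hvw => by
    rw [← hmono.lt_iff_lt (hψ v hv).1.le (hψ w hw).1.le, (hψ v hv).2, (hψ w hw).2]
    exact hvw
  have himg : ψ '' Ioi (φ a) = Ioi a := by
    ext u
    exact ⟨by rintro ⟨v, hv, rfl⟩; exact (hψ v hv).1, fun hu => ⟨φ u, hlt u hu, hleft u hu⟩⟩
  have hd : ∀ v, φ a < v → HasDerivAt ψ (deriv φ (ψ v))⁻¹ v := fun v hv => by
    have hav := (hψ v hv).1
    refine HasDerivAt.of_local_left_inverse (f := φ) ?_ ?_ (hpos _ hav).ne' ?_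
    · exact hψmono.continuousAt_of_image_mem_nhds (Ioi_mem_nhds hv)
        (himg ▸ Ioi_mem_nhds hav)
    · exact ((hs.differentiableOn (by simp)).differentiableAt (Ici_mem_nhds hav)).hasDerivAt
    · filter_upwards [Ioi_mem_nhds hv] with w hw using (hψ w hw).2
  have hs' : ContDiffOn ℝ (⊤ : ℕ∞) (fun u => (deriv φ u)⁻¹) (Ioi a) :=
    ((hs.mono Ioi_subset_Ici_self).deriv_of_isOpen isOpen_Ioi (by simp)).inv
      fun u hu => (hpos u hu).ne'
  refine ⟨ψ, hψ, hleft, ?_, hd, ?_⟩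
  · refine tendsto_atTop.2 fun B => ?_
    have haB : a < max B (a + 1) := lt_max_of_lt_right (lt_add_one a)
    filter_upwards [eventually_gt_atTop (φ (max B (a + 1)))] with v hv
    have := hψmono (hlt _ haB) ((hlt _ haB).trans hv) hv
    rw [hleft _ haB] at this
    exact (le_max_left _ _).trans this.le
  · refine contDiffOn_infty.2 fun n => ?_
    have hdiff : DifferentiableOn ℝ ψ (Ioi (φ a)) := fun v hv =>
      (hd v hv).differentiableAt.differentiableWithinAt
    induction n with
    | zero => exact contDiffOn_zero.2 hdiff.continuousOn
    | succ n ih =>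
      push_cast
      refine (contDiffOn_succ_iff_deriv_of_isOpen isOpen_Ioi).2 ⟨hdiff, by simp, ?_⟩
      exact ((hs'.of_le (by exact_mod_cast le_top)).comp ih fun v hv => (hψ v hv).1).congr
        fun v hv => (hd v hv).deriv

/-- The function `y ↦ y f'(y) - f(y) + k(y)` is regularly varying of index `α`, in logarithmic
coordinates. -/
theorem SmoothRegVary.exists_log_mul_deriv_sub_add {α b : ℝ} (hα : 1 < α) (hb : b < α)
    {f k : ℝ → ℝ} (hf : SmoothRegVary α f) (hk : SmoothRegVary b k) :
    ∃ (a : ℝ) (φ : ℝ → ℝ), ContDiffOn ℝ (⊤ : ℕ∞) φ (Ioi a) ∧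
      (∀ n, FlatAtTop n α (deriv φ)) ∧
      ∀ u, a < u → Real.exp u * deriv f (Real.exp u) - f (Real.exp u) + k (Real.exp u) =
        Real.exp (φ u) := by
  obtain ⟨a₁, F, hF, hFflat, hfF, hfF'⟩ := hf.exists_log_comp_exp
  obtain ⟨a₂, K, hK, hKflat, hkK, -⟩ := hk.exists_log_comp_exp
  have hsub : ∀ {a a' : ℝ} {φ : ℝ → ℝ}, ContDiffOn ℝ (⊤ : ℕ∞) φ (Ioi a) → a ≤ a' →
      ContDiffOn ℝ (⊤ : ℕ∞) φ (Ioi a') := fun h haa => h.mono (Ioi_subset_Ioi haa)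
  have hdiff : ∀ {a : ℝ} {φ : ℝ → ℝ}, ContDiffOn ℝ (⊤ : ℕ∞) φ (Ioi a) →
      ∀ᶠ u in atTop, DifferentiableAt ℝ φ u := fun {a φ} h => by
    filter_upwards [Ioi_mem_atTop a] with u hu
    exact (h.differentiableOn (by simp)).differentiableAt (Ioi_mem_nhds hu)
  have hFK : ∀ n, FlatAtTop n (α - b) (deriv fun u => F u - K u) := fun n => by
    refine sub_eq_add_neg α b ▸ ((hFflat n).add (hKflat n).neg).congr ?_
    filter_upwards [hdiff hF, hdiff hK] with u h₁ h₂
    rw [← sub_eq_add_neg]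
    exact (h₁.hasDerivAt.sub h₂.hasDerivAt).deriv.symm
  have hFKd : ∀ᶠ u in atTop, DifferentiableAt ℝ (fun u => F u - K u) u := by
    filter_upwards [hdiff hF, hdiff hK] with u h₁ h₂ using h₁.sub h₂
  have hKF : ∀ n, FlatAtTop n 0 fun u => Real.exp (-(F u - K u)) :=
    FlatAtTop.exp_of_tendsto_atBot (d := -(α - b))
      (tendsto_neg_atTop_atBot.comp
        (tendsto_atTop_of_tendsto_deriv (sub_pos.2 hb) hFKd (hFK 0).tendsto))
      (hFKd.mono fun u hu => hu.neg)
      fun n => (hFK n).neg.congr (.of_forall fun u => (deriv.fun_neg (f := fun u => F u - K u)).symm)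
  set q : ℝ → ℝ := fun u => deriv F u + -1 + Real.exp (-(F u - K u)) with hq
  have hqflat : ∀ n, FlatAtTop n (α - 1) q := fun n => by
    have := ((hFflat n).add (.const n (-1))).add (hKF n)
    rwa [add_zero, ← sub_eq_add_neg] at this
  obtain ⟨a₃, hq0⟩ := eventually_atTop.1
    ((hqflat 0).tendsto.eventually_const_lt (sub_pos.2 hα))
  set a := max (max a₁ a₂) a₃
  have h₁ : a₁ ≤ a := (le_max_left _ _).trans (le_max_left _ _)
  have h₂ : a₂ ≤ a := (le_max_right _ _).trans (le_max_left _ _)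
  have hqpos : ∀ u, a < u → 0 < q u := fun u hu => hq0 u ((le_max_right _ _).trans hu.le)
  have hqs : ContDiffOn ℝ (⊤ : ℕ∞) q (Ioi a) :=
    (((hsub hF h₁).deriv_of_isOpen isOpen_Ioi (by simp)).add contDiffOn_const).add
      ((hsub hF h₁).sub (hsub hK h₂)).neg.exp
  refine ⟨a, fun u => F u + Real.log (q u),
    (hsub hF h₁).add (hqs.log fun u hu => (hqpos u hu).ne'), fun n => ?_, fun u hu => ?_⟩
  · have := (hFflat n).add ((hqflat (n + 1)).2.2.mul ((hqflat n).inv (sub_pos.2 hα).ne'))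
    simp only [zero_mul, add_zero] at this
    refine this.congr ?_
    filter_upwards [hdiff hF, hdiff hqs, Ioi_mem_atTop a] with u d₁ d₂ hu
    rw [← div_eq_mul_inv]
    exact (d₁.hasDerivAt.add (d₂.hasDerivAt.log (hqpos u hu).ne')).deriv.symm
  · rw [hfF' u (h₁.trans_lt hu), hfF u (h₁.trans_lt hu), hkK u (h₂.trans_lt hu), Real.exp_add,
      Real.exp_log (hqpos u hu), hq]
    have : Real.exp (K u) = Real.exp (F u) * Real.exp (-(F u - K u)) := by
      rw [← Real.exp_add]; congr 1; ring
    rw [this]; ring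

/-- Lemma 2.6(i): existence, uniqueness and regularity of the solution `g` of the
nonlinear functional equation `g(Λ) f'(g(Λ)) - f(g(Λ)) + k(g(Λ)) = ln Λ`:
`g ∈ SR₀` and `u ↦ g (e^u) ∈ SR_{1/α}`. -/
theorem stmt4 {α b : ℝ} (hα : 1 < α) (hb : b < α) {f k : ℝ → ℝ}
    (hf : SmoothRegVary α f) (hk : SmoothRegVary b k) :
    ∃ z₀ r₀ : ℝ, 1 ≤ z₀ ∧ 0 < r₀ ∧
      ∃ g : ℝ → ℝ,
        (∀ Λ : ℝ, r₀ < Λ →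
          (z₀ < g Λ ∧ g Λ * deriv f (g Λ) - f (g Λ) + k (g Λ) = Real.log Λ) ∧
          ∀ y : ℝ, z₀ < y → y * deriv f y - f y + k y = Real.log Λ → y = g Λ) ∧
        SmoothRegVary 0 g ∧
        SmoothRegVary α⁻¹ (fun u : ℝ => g (Real.exp u)) := by
  obtain ⟨a, φ, hs, hflat, heq⟩ := hf.exists_log_mul_deriv_sub_add hα hb hk
  have hα0 : 0 < α := by linarith
  obtain ⟨a', ha'⟩ := eventually_atTop.1 ((hflat 0).tendsto.eventually_const_lt hα0)
  obtain ⟨c, hca, hca', hc0⟩ := ((eventually_gt_atTop a).and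
    ((eventually_ge_atTop a').and (eventually_ge_atTop 0))).exists
  have hφ : Tendsto φ atTop atTop := by
    refine tendsto_atTop_of_tendsto_deriv hα0 ?_ (hflat 0).tendsto
    filter_upwards [Ioi_mem_atTop a] with u hu
    exact (hs.differentiableOn (by simp)).differentiableAt (Ioi_mem_nhds hu)
  obtain ⟨ψ, hψ, hleft, hψtop, hψd, hψs⟩ := exists_smooth_inverse
    (hs.mono (Ici_subset_Ioi.2 hca)) (fun u hu => ha' u (hca'.trans hu.le)) hφ
  have hψflat : ∀ n, FlatAtTop n α⁻¹ (deriv ψ) := fun n => by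
    have hd : ∀ᶠ v in atTop, HasDerivAt ψ (deriv φ (ψ v))⁻¹ v :=
      (eventually_gt_atTop (φ c)).mono hψd
    exact (FlatAtTop.comp_autonomous hψtop hd (fun n => (hflat n).inv hα0.ne')
      ((hflat n).inv hα0.ne')).congr (hd.mono fun v hv => hv.deriv.symm)
  have hlogflat : ∀ n, FlatAtTop n 0 (deriv fun u => ψ (Real.log u)) := fun n => by
    have hd : ∀ᶠ u in atTop, HasDerivAt Real.log u⁻¹ u :=
      (eventually_ne_atTop 0).mono fun u hu => Real.hasDerivAt_log hu
    have := ((hψflat n).comp Real.tendsto_log_atTop hd fun m _ => .inv_id m).mul (.inv_id n)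
    rw [mul_zero] at this
    refine this.congr ?_
    filter_upwards [hd, Real.tendsto_log_atTop.eventually (eventually_gt_atTop (φ c))]
      with u h₁ h₂
    exact ((hψd _ h₂).differentiableAt.hasDerivAt.comp u h₁).deriv.symm
  have hloglt : ∀ x, Real.exp (φ c) < x → φ c < Real.log x := fun x hx =>
    (Real.lt_log_iff_exp_lt ((Real.exp_pos _).trans hx)).2 hx
  have hs₁ : ContDiffOn ℝ (⊤ : ℕ∞) (fun u => Real.exp (ψ (Real.log u)))
      (Ioi (Real.exp (φ c))) :=
    (hψs.comp (contDiffOn_id.log fun x hx => ((Real.exp_pos _).trans hx).ne') hloglt).exp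
  have hlt₂ : ∀ x, Real.exp (Real.exp (φ c)) < x → Real.exp (φ c) < Real.log x := fun x hx =>
    (Real.lt_log_iff_exp_lt ((Real.exp_pos _).trans hx)).2 hx
  refine ⟨Real.exp c, Real.exp (Real.exp (φ c)), Real.one_le_exp hc0, Real.exp_pos _,
    fun x => Real.exp (ψ (Real.log (Real.log x))), fun x hx => ?_, ?_, ?_⟩
  · have hx₁ := hlt₂ x hx
    obtain ⟨h₁, h₂⟩ := hψ _ (hloglt _ hx₁)
    refine ⟨⟨Real.exp_lt_exp.2 h₁, ?_⟩, fun y hy hyx => ?_⟩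
    · rw [heq _ (hca.trans h₁), h₂, Real.exp_log ((Real.exp_pos _).trans hx₁)]
    · have hy0 : 0 < y := (Real.exp_pos _).trans hy
      have hcy : c < Real.log y := (Real.lt_log_iff_exp_lt hy0).2 hy
      have := heq _ (hca.trans hcy)
      rw [Real.exp_log hy0, hyx] at this
      dsimp only
      rw [this, Real.log_exp, hleft _ hcy, Real.exp_log hy0]
  · refine .of_log_comp_exp (Real.one_le_exp (Real.exp_pos _).le) (fun x _ => Real.exp_pos _)
      (hs₁.comp (contDiffOn_id.log fun x hx => ((Real.exp_pos _).trans hx).ne') hlt₂)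
      (fun u => ?_) hlogflat
    simp
  · refine .of_log_comp_exp (le_max_left 1 (Real.exp (φ c))) (fun x _ => Real.exp_pos _)
      ?_ (φ := ψ) (fun u => ?_) hψflat
    · simp only [Real.log_exp]
      exact hs₁.mono (Ioi_subset_Ioi (le_max_right _ _))
    · simp
end
end

section
/- Let α > 1, f ∈ SR_α, b < α, k ∈ SR_b, and let g be the solution of g(Λ)·f′(g(Λ)) − f(g(Λ)) + k(g(Λ)) = ln Λ, defined for Λ larger than some r₀ > 0. Then for each γ > 0 and δ > 0 there is z > r₀ such that for every Λ > z and every y ∈ [(ln Λ)^{−γ}, (ln Λ)^{γ}] one has |g(Λ)·(f′(g(yΛ)) − f′(g(Λ))) − ln y| ≤ δ·|ln y|. -/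
open MeasureTheory Filter Real Set
open scoped Topology BigOperators ENNReal

noncomputable section

namespace SmoothRegVary

variable {α b : ℝ} {f k : ℝ → ℝ}

lemma eventually_pos (hf : SmoothRegVary α f) : ∀ᶠ x in atTop, 0 < f x := by
  obtain ⟨z₀, -, hpos, -⟩ := hf
  filter_upwards [eventually_gt_atTop z₀] with x hx using hpos x hx

lemma eventually_contDiffAt (hf : SmoothRegVary α f) :
    ∀ᶠ x in atTop, ContDiffAt ℝ (⊤ : ℕ∞) f x := by
  obtain ⟨z₀, -, -, hc, -⟩ := hf
  filter_upwards [eventually_gt_atTop z₀] with x hx using hc.contDiffAt (Ioi_mem_nhds hx)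

lemma eventually_hasDerivAt (hf : SmoothRegVary α f) :
    ∀ᶠ x in atTop, HasDerivAt f (deriv f x) x := by
  filter_upwards [hf.eventually_contDiffAt] with x hx
    using (hx.differentiableAt (by simp)).hasDerivAt

lemma eventually_hasDerivAt_deriv (hf : SmoothRegVary α f) :
    ∀ᶠ x in atTop, HasDerivAt (deriv f) (deriv (deriv f) x) x := by
  obtain ⟨z₀, -, -, hc, -⟩ := hf
  filter_upwards [eventually_gt_atTop z₀] with x hx
  have h := hc.deriv_of_isOpen (m := 1) isOpen_Ioi (by norm_cast)
  exact ((h.contDiffAt (Ioi_mem_nhds hx)).differentiableAt (by simp)).hasDerivAt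

/-- The logarithmic derivative of `f` in the variable `u = log x`. -/
lemma eventually_hasDerivAt_log_exp (hf : SmoothRegVary α f) :
    ∀ᶠ u in atTop, HasDerivAt (fun u => log (f (exp u)))
      (exp u * deriv f (exp u) / f (exp u)) u := by
  filter_upwards [tendsto_exp_atTop.eventually hf.eventually_pos,
    tendsto_exp_atTop.eventually hf.eventually_hasDerivAt] with u hpos hd
  refine ((hd.comp u (Real.hasDerivAt_exp u)).log hpos.ne').congr_deriv ?_
  rw [Function.comp_apply, mul_comm]

lemma tendsto_mul_deriv_div (hf : SmoothRegVary α f) :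
    Tendsto (fun x => x * deriv f x / f x) atTop (𝓝 α) := by
  obtain ⟨-, -, -, -, h₁, -⟩ := id hf
  have h : Tendsto (fun u => exp u * deriv f (exp u) / f (exp u)) atTop (𝓝 α) :=
    h₁.congr' (hf.eventually_hasDerivAt_log_exp.mono fun u hu => hu.deriv)
  refine (h.comp tendsto_log_atTop).congr' ?_
  filter_upwards [eventually_gt_atTop 0] with x hx
  simp [Real.exp_log hx]

lemma tendsto_sq_mul_deriv_deriv_div (hf : SmoothRegVary α f) :
    Tendsto (fun x => x ^ 2 * deriv (deriv f) x / f x) atTop (𝓝 (α * (α - 1))) := by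
  obtain ⟨-, -, -, -, h₁, h₂⟩ := id hf
  have h₂ := h₂ 2 le_rfl
  have key : ∀ᶠ u in atTop, exp u ^ 2 * deriv (deriv f) (exp u) / f (exp u) =
      iteratedDeriv 2 (fun u => log (f (exp u))) u
        - deriv (fun u => log (f (exp u))) u + deriv (fun u => log (f (exp u))) u ^ 2 := by
    obtain ⟨U, hU⟩ := eventually_atTop.1 hf.eventually_hasDerivAt_log_exp
    filter_upwards [eventually_gt_atTop U, tendsto_exp_atTop.eventually hf.eventually_pos,
      tendsto_exp_atTop.eventually hf.eventually_hasDerivAt,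
      tendsto_exp_atTop.eventually hf.eventually_hasDerivAt_deriv] with u hu hpos hd hdd
    have heq : deriv (fun u => log (f (exp u))) =ᶠ[𝓝 u]
        fun u => exp u * deriv f (exp u) / f (exp u) := by
      filter_upwards [Ioi_mem_nhds hu] with v hv using (hU v (le_of_lt hv)).deriv
    have he := Real.hasDerivAt_exp u
    have hquot := (he.mul (hdd.comp u he)).div (hd.comp u he) hpos.ne'
    rw [iteratedDeriv_succ, iteratedDeriv_one, (hquot.congr_of_eventuallyEq heq).deriv,
      heq.eq_of_nhds]
    simp only [Function.comp_apply, Pi.mul_apply]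
    field_simp
    ring
  have hlim := (h₂.sub h₁).add (h₁.pow 2)
  rw [show 0 - α + α ^ 2 = α * (α - 1) by ring] at hlim
  refine ((hlim.congr' (key.mono fun _ h => h.symm)).comp tendsto_log_atTop).congr' ?_
  filter_upwards [eventually_gt_atTop 0] with x hx
  simp [Real.exp_log hx]

/-- A smoothly regularly varying function is negligible against one of larger index. -/
lemma tendsto_div_zero (hf : SmoothRegVary α f) (hk : SmoothRegVary b k) (hb : b < α) :
    Tendsto (fun x => k x / f x) atTop (𝓝 0) := by
  set D : ℝ → ℝ := fun u => log (k (exp u)) - log (f (exp u)) with hD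
  have hder : Tendsto (fun u => exp u * deriv k (exp u) / k (exp u)
      - exp u * deriv f (exp u) / f (exp u)) atTop (𝓝 (b - α)) :=
    (hk.tendsto_mul_deriv_div.sub hf.tendsto_mul_deriv_div).comp tendsto_exp_atTop
  obtain ⟨U, hU⟩ := eventually_atTop.1 ((hk.eventually_hasDerivAt_log_exp.and
    hf.eventually_hasDerivAt_log_exp).and
      (hder.eventually_lt_const (show b - α < (b - α) / 2 by linarith)))
  have hDd : ∀ u, U ≤ u → HasDerivAt D (exp u * deriv k (exp u) / k (exp u)
      - exp u * deriv f (exp u) / f (exp u)) u := fun u hu =>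
    (hU u hu).1.1.sub (hU u hu).1.2
  have hbound : ∀ u, U ≤ u → D u ≤ D U + (b - α) / 2 * (u - U) := by
    intro u hu
    have := Convex.image_sub_le_mul_sub_of_deriv_le (convex_Ici U)
      (fun v hv => (hDd v hv).continuousAt.continuousWithinAt)
      (fun v hv => (hDd v (interior_subset hv)).differentiableAt.differentiableWithinAt)
      (C := (b - α) / 2)
      (fun v hv => by
        rw [(hDd v (interior_subset hv)).deriv]
        exact (hU v (interior_subset hv)).2.le)
      U (mem_Ici.2 le_rfl) u (mem_Ici.2 hu) hu
    linarith
  have hDbot : Tendsto D atTop atBot := by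
    refine tendsto_atBot_mono' _ (eventually_atTop.2 ⟨U, hbound⟩) ?_
    refine tendsto_atBot_add_const_left _ _ ?_
    exact (tendsto_atTop_add_const_right _ (-U) tendsto_id).const_mul_atTop_of_neg
      (by linarith)
  refine ((Real.tendsto_exp_atBot.comp hDbot).comp tendsto_log_atTop).congr' ?_
  filter_upwards [eventually_gt_atTop 0, hf.eventually_pos, hk.eventually_pos] with x hx hfx hkx
  simp [hD, Real.exp_log hx, Real.exp_sub, Real.exp_log hfx, Real.exp_log hkx]

/-- Asymptotically equal values of `f` are attained at asymptotically equal arguments. -/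
lemma tendsto_div_one {ι : Type*} {l : Filter ι} (hf : SmoothRegVary α f) (hα : 0 < α)
    {a c : ι → ℝ} (ha : Tendsto a l atTop) (hc : Tendsto c l atTop)
    (h : Tendsto (fun p => f (c p) / f (a p)) l (𝓝 1)) :
    Tendsto (fun p => c p / a p) l (𝓝 1) := by
  set L : ℝ → ℝ := fun u => log (f (exp u)) with hL
  obtain ⟨U, hU⟩ := eventually_atTop.1 (hf.eventually_hasDerivAt_log_exp.and
    ((hf.tendsto_mul_deriv_div.comp tendsto_exp_atTop).eventually_const_lt
      (show α / 2 < α by linarith)))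
  have hle : ∀ u v, U ≤ u → u ≤ v → α / 2 * (v - u) ≤ L v - L u := by
    intro u v hu huv
    exact Convex.mul_sub_le_image_sub_of_le_deriv (convex_Ici U)
      (fun w hw => (hU w hw).1.continuousAt.continuousWithinAt)
      (fun w hw => (hU w (interior_subset hw)).1.differentiableAt.differentiableWithinAt)
      (fun w hw => by
        rw [(hU w (interior_subset hw)).1.deriv]
        exact (hU w (interior_subset hw)).2.le)
      u (mem_Ici.2 hu) v (mem_Ici.2 (hu.trans huv)) huv
  have habs : ∀ u v, U ≤ u → U ≤ v → |v - u| ≤ 2 / α * |L v - L u| := by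
    intro u v hu hv
    have : α / 2 * |v - u| ≤ |L v - L u| := by
      rcases le_total u v with huv | huv
      · rw [abs_of_nonneg (sub_nonneg.2 huv)]
        exact (hle u v hu huv).trans (le_abs_self _)
      · rw [abs_sub_comm v u, abs_of_nonneg (sub_nonneg.2 huv), abs_sub_comm]
        exact (hle v u hv huv).trans (le_abs_self _)
    calc |v - u| = 2 / α * (α / 2 * |v - u|) := by field_simp
      _ ≤ _ := by gcongr
  have hlog : Tendsto (fun p => 2 / α * |log (f (c p) / f (a p))|) l (𝓝 0) := by
    simpa using ((h.log one_ne_zero).abs).const_mul (2 / α)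
  have hlog' : Tendsto (fun p => log (c p / a p)) l (𝓝 0) := by
    refine squeeze_zero_norm' ?_ hlog
    filter_upwards [(tendsto_log_atTop.comp ha).eventually_ge_atTop U,
      (tendsto_log_atTop.comp hc).eventually_ge_atTop U,
      ha.eventually_gt_atTop 0, hc.eventually_gt_atTop 0, ha.eventually hf.eventually_pos,
      hc.eventually hf.eventually_pos] with p h1 h2 hap hcp hfa hfc
    have := habs _ _ h1 h2
    simp only [hL, Function.comp_apply, Real.exp_log hap, Real.exp_log hcp] at this
    rwa [Real.norm_eq_abs, Real.log_div hcp.ne' hap.ne', Real.log_div hfc.ne' hfa.ne']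
  have := hlog'.rexp
  rw [Real.exp_zero] at this
  refine this.congr' ?_
  filter_upwards [ha.eventually_gt_atTop 0, hc.eventually_gt_atTop 0] with p hap hcp
  exact Real.exp_log (div_pos hcp hap)

lemma eventually_hasDerivAt_legendre (hf : SmoothRegVary α f) (hk : SmoothRegVary b k) :
    ∀ᶠ x in atTop, HasDerivAt (fun x => x * deriv f x - f x + k x)
      (x * deriv (deriv f) x + deriv k x) x := by
  filter_upwards [hf.eventually_hasDerivAt, hf.eventually_hasDerivAt_deriv,
    hk.eventually_hasDerivAt] with x h1 h2 h3
  refine ((((hasDerivAt_id x).mul h2).sub h1).add h3).congr_deriv ?_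
  rw [one_mul, id, add_sub_cancel_left]

lemma tendsto_legendre_div (hf : SmoothRegVary α f) (hk : SmoothRegVary b k) (hb : b < α) :
    Tendsto (fun x => (x * deriv f x - f x + k x) / f x) atTop (𝓝 (α - 1)) := by
  have h := (hf.tendsto_mul_deriv_div.sub_const 1).add (hf.tendsto_div_zero hk hb)
  rw [add_zero] at h
  refine h.congr' ?_
  filter_upwards [hf.eventually_pos] with x hx
  field_simp

lemma tendsto_mul_deriv_legendre_div (hf : SmoothRegVary α f) (hk : SmoothRegVary b k)
    (hb : b < α) :
    Tendsto (fun x => x * (x * deriv (deriv f) x + deriv k x) / f x) atTop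
      (𝓝 (α * (α - 1))) := by
  have h := hf.tendsto_sq_mul_deriv_deriv_div.add
    (hk.tendsto_mul_deriv_div.mul (hf.tendsto_div_zero hk hb))
  rw [mul_zero, add_zero] at h
  refine h.congr' ?_
  filter_upwards [hf.eventually_pos, hk.eventually_pos] with x hx hkx
  field_simp

lemma tendsto_mul_deriv_deriv_div_legendre (hf : SmoothRegVary α f) (hk : SmoothRegVary b k)
    (hα : 1 < α) (hb : b < α) :
    Tendsto (fun x => x * deriv (deriv f) x / (x * deriv (deriv f) x + deriv k x)) atTop
      (𝓝 1) := by
  have hne : α * (α - 1) ≠ 0 := (mul_pos (by linarith) (by linarith)).ne'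
  have h := hf.tendsto_sq_mul_deriv_deriv_div.div (hf.tendsto_mul_deriv_legendre_div hk hb) hne
  rw [div_self hne] at h
  refine h.congr' ?_
  filter_upwards [hf.eventually_pos, eventually_gt_atTop 0] with x hx hx0
  rw [Pi.div_apply, div_div_div_cancel_right₀ hx.ne', pow_two, mul_assoc,
    mul_div_mul_left _ _ hx0.ne']

lemma eventually_deriv_legendre_pos (hf : SmoothRegVary α f) (hk : SmoothRegVary b k)
    (hα : 1 < α) (hb : b < α) :
    ∀ᶠ x in atTop, 0 < x * deriv (deriv f) x + deriv k x := by
  filter_upwards [(hf.tendsto_mul_deriv_legendre_div hk hb).eventually_const_lt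
    (mul_pos (by linarith) (by linarith)), hf.eventually_pos, eventually_gt_atTop 0]
    with x h hx hx0
  have := (div_pos_iff_of_pos_right hx).1 h
  exact (mul_pos_iff_of_pos_left hx0).1 this

/-- Increments of `f'` between two solutions of `x f' - f + k = T` with close right-hand sides. -/
lemma eventually_abs_mul_deriv_sub_le {ι : Type*} {l : Filter ι} (hf : SmoothRegVary α f)
    (hk : SmoothRegVary b k) (hα : 1 < α) (hb : b < α) {a c T s : ι → ℝ}
    (ha : Tendsto a l atTop) (hc : Tendsto c l atTop) (hT : Tendsto T l atTop)
    (hs : Tendsto (fun p => s p / T p) l (𝓝 0))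
    (hTa : ∀ᶠ p in l, a p * deriv f (a p) - f (a p) + k (a p) = T p)
    (hTc : ∀ᶠ p in l, c p * deriv f (c p) - f (c p) + k (c p) = s p + T p)
    {δ : ℝ} (hδ : 0 < δ) :
    ∀ᶠ p in l, |a p * (deriv f (c p) - deriv f (a p)) - s p| ≤ δ * |s p| := by
  rcases l.eq_or_neBot with rfl | _
  · exact eventually_bot
  have hα1 : α - 1 ≠ 0 := by linarith
  have hfrac : Tendsto (fun p => f (c p) / f (a p)) l (𝓝 1) := by
    have hΦ := hf.tendsto_legendre_div hk hb
    have h := ((hs.add_const 1).mul (hΦ.comp ha)).div (hΦ.comp hc) hα1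
    rw [zero_add, one_mul, div_self hα1] at h
    refine h.congr' ?_
    filter_upwards [hTa, hTc, ha.eventually hf.eventually_pos, hc.eventually hf.eventually_pos,
      hT.eventually_gt_atTop 0, (hΦ.comp hc).eventually_ne hα1] with p h1 h2 h3 h4 h5 h6
    simp only [Function.comp_apply, Pi.div_apply, h1, h2] at h6 ⊢
    have h7 : s p + T p ≠ 0 := fun h0 => h6 (by simp [h0])
    field_simp
  have hca := hf.tendsto_div_one (by linarith) ha hc hfrac
  have hmvt : ∀ᶠ p in l, ∃ ξ ∈ uIcc (a p) (c p), (deriv f (c p) - deriv f (a p)) *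
      (ξ * deriv (deriv f) ξ + deriv k ξ) = deriv (deriv f) ξ * s p := by
    obtain ⟨M, hM⟩ := eventually_atTop.1 ((hf.eventually_hasDerivAt_legendre hk).and
      hf.eventually_hasDerivAt_deriv)
    have key : ∀ u v, M ≤ u → u < v → ∃ ξ ∈ Icc u v, (deriv f v - deriv f u) *
      (ξ * deriv (deriv f) ξ + deriv k ξ) = deriv (deriv f) ξ *
        ((v * deriv f v - f v + k v) - (u * deriv f u - f u + k u)) := by
      intro u v hu huv
      obtain ⟨ξ, hξ, h⟩ := exists_ratio_hasDerivAt_eq_ratio_slope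
        (fun x => x * deriv f x - f x + k x) (fun x => x * deriv (deriv f) x + deriv k x) huv
        (fun x hx => (hM x (hu.trans hx.1)).1.continuousAt.continuousWithinAt)
        (fun x hx => (hM x (hu.trans hx.1.le)).1) (deriv f) (deriv (deriv f))
        (fun x hx => (hM x (hu.trans hx.1)).2.continuousAt.continuousWithinAt)
        (fun x hx => (hM x (hu.trans hx.1.le)).2)
      exact ⟨ξ, Ioo_subset_Icc_self hξ, by linarith⟩
    filter_upwards [hTa, hTc, ha.eventually_ge_atTop M, hc.eventually_ge_atTop M]
      with p h1 h2 h3 h4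
    rcases lt_trichotomy (a p) (c p) with h | h | h
    · obtain ⟨ξ, hξ, e⟩ := key _ _ h3 h
      refine ⟨ξ, Icc_subset_uIcc hξ, ?_⟩
      rw [e, h1, h2]
      ring
    · refine ⟨a p, left_mem_uIcc, ?_⟩
      have : s p = 0 := by
        rw [← h, h1] at h2
        linarith
      rw [h, this]
      ring
    · obtain ⟨ξ, hξ, e⟩ := key _ _ h4 h
      refine ⟨ξ, Icc_subset_uIcc' hξ, ?_⟩
      rw [h1, h2] at e
      linear_combination -e
  obtain ⟨ξ, hξ⟩ := hmvt.choice
  have hmin : Tendsto ξ l atTop := by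
    rw [tendsto_atTop]
    intro M
    filter_upwards [hξ, ha.eventually_ge_atTop M, hc.eventually_ge_atTop M] with p h h1 h2
    exact (le_inf h1 h2).trans h.1.1
  have hξa : Tendsto (fun p => ξ p / a p) l (𝓝 1) := by
    have hlo : Tendsto (fun p => min 1 (c p / a p)) l (𝓝 1) := by
      simpa using tendsto_const_nhds (x := (1 : ℝ)).min hca
    have hhi : Tendsto (fun p => max 1 (c p / a p)) l (𝓝 1) := by
      simpa using tendsto_const_nhds (x := (1 : ℝ)).max hca
    refine tendsto_of_tendsto_of_tendsto_of_le_of_le' hlo hhi ?_ ?_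
    · filter_upwards [hξ, ha.eventually_gt_atTop 0] with p h h0
      rw [← div_self h0.ne', min_div_div_right h0.le]
      gcongr
      exact h.1.1
    · filter_upwards [hξ, ha.eventually_gt_atTop 0] with p h h0
      rw [← div_self h0.ne', max_div_div_right h0.le]
      gcongr
      exact h.1.2
  have hprod := ((hf.tendsto_mul_deriv_deriv_div_legendre hk hα hb).comp hmin).div hξa
    one_ne_zero
  rw [div_one] at hprod
  filter_upwards [hξ, Metric.tendsto_nhds.1 hprod δ hδ, ha.eventually_gt_atTop 0,
    hmin.eventually_gt_atTop 0, hmin.eventually (hf.eventually_deriv_legendre_pos hk hα hb)]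
    with p h hd h0 h1 h2
  rw [Real.dist_eq] at hd
  simp only [Pi.div_apply, Function.comp_apply] at hd
  have e : a p * (deriv f (c p) - deriv f (a p)) - s p =
      (ξ p * deriv (deriv f) (ξ p) / (ξ p * deriv (deriv f) (ξ p) + deriv k (ξ p)) /
        (ξ p / a p) - 1) * s p := by
    rw [eq_div_of_mul_eq h2.ne' h.2]
    field_simp
  rw [e, abs_mul]
  gcongr

end SmoothRegVary

lemma Real.tendsto_log_log_div_log_atTop :
    Tendsto (fun x => log (log x) / log x) atTop (𝓝 0) :=
  (Real.isLittleO_log_id_atTop.tendsto_div_nhds_zero).comp tendsto_log_atTop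

/-- Lemma 2.6(ii): the asymptotic cancellation relation
`|g(Λ)(f'(g(yΛ)) - f'(g(Λ))) - ln y| ≤ δ |ln y|` uniformly for
`y ∈ [(ln Λ)^{-γ}, (ln Λ)^{γ}]` and `Λ` large. -/
theorem stmt5 {α b : ℝ} (hα : 1 < α) (hb : b < α) {f k : ℝ → ℝ}
    (hf : SmoothRegVary α f) (hk : SmoothRegVary b k)
    (r₀ : ℝ) (hr₀ : 0 < r₀) (g : ℝ → ℝ)
    (hgtop : Filter.Tendsto g Filter.atTop Filter.atTop)
    (hg : ∀ Λ : ℝ, r₀ < Λ →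
      g Λ * deriv f (g Λ) - f (g Λ) + k (g Λ) = Real.log Λ) :
    ∀ γ > (0 : ℝ), ∀ δ > (0 : ℝ), ∃ z > r₀, ∀ Λ : ℝ, z < Λ →
      ∀ y ∈ Set.Icc ((Real.log Λ) ^ (-γ)) ((Real.log Λ) ^ γ),
        |g Λ * (deriv f (g (y * Λ)) - deriv f (g Λ)) - Real.log y| ≤ δ * |Real.log y| := by
  intro γ hγ δ hδ
  set l : Filter (ℝ × ℝ) := comap Prod.fst atTop ⊓
    𝓟 {p | p.2 ∈ Icc (log p.1 ^ (-γ)) (log p.1 ^ γ)} with hl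
  have hΛ : Tendsto (fun p : ℝ × ℝ => p.1) l atTop := tendsto_comap.mono_left inf_le_left
  have hlogΛ := tendsto_log_atTop.comp hΛ
  have hmem : ∀ᶠ p in l, p.2 ∈ Icc (log p.1 ^ (-γ)) (log p.1 ^ γ) :=
    eventually_inf_principal.2 (Eventually.of_forall fun _ h => h)
  have hy : ∀ᶠ p in l, 0 < p.2 := by
    filter_upwards [hmem, hlogΛ.eventually_gt_atTop 0] with p h h0
    exact (rpow_pos_of_pos h0 _).trans_le h.1
  have hs : Tendsto (fun p => log p.2 / log p.1) l (𝓝 0) := by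
    have hlim : Tendsto (fun p : ℝ × ℝ => γ * (log (log p.1) / log p.1)) l (𝓝 0) := by
      simpa using (Real.tendsto_log_log_div_log_atTop.comp hΛ).const_mul γ
    refine squeeze_zero_norm' ?_ hlim
    filter_upwards [hmem, hy, hlogΛ.eventually_gt_atTop 0] with p h hy h0
    have h0 : 0 < log p.1 := h0
    have h1 := Real.log_le_log (rpow_pos_of_pos h0 _) h.1
    have h2 := Real.log_le_log hy h.2
    rw [Real.log_rpow h0] at h1 h2
    rw [norm_div, Real.norm_of_nonneg h0.le, Real.norm_eq_abs, ← mul_div_assoc]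
    gcongr
    exact abs_le.2 ⟨by linarith, h2⟩
  have hlogmul : ∀ᶠ p in l, log (p.2 * p.1) = log p.2 + log p.1 := by
    filter_upwards [hy, hΛ.eventually_gt_atTop 0] with p h1 h2
    exact Real.log_mul h1.ne' h2.ne'
  have hyΛ : Tendsto (fun p : ℝ × ℝ => p.2 * p.1) l atTop := by
    have h : Tendsto (fun p : ℝ × ℝ => log p.2 + log p.1) l atTop := by
      refine ((hs.add_const 1).pos_mul_atTop (by norm_num) hlogΛ).congr' ?_
      filter_upwards [hlogΛ.eventually_gt_atTop 0] with p h
      have h : 0 < log p.1 := h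
      simp only [Function.comp_apply]
      field_simp
    refine (tendsto_exp_atTop.comp h).congr' ?_
    filter_upwards [hlogmul, hy, hΛ.eventually_gt_atTop 0] with p h h1 h2
    rw [Function.comp_apply, ← h, Real.exp_log (mul_pos h1 h2)]
  have hTc : ∀ᶠ p in l, g (p.2 * p.1) * deriv f (g (p.2 * p.1)) - f (g (p.2 * p.1))
      + k (g (p.2 * p.1)) = log p.2 + log p.1 := by
    filter_upwards [hyΛ.eventually_gt_atTop r₀, hlogmul] with p h e
    rw [hg _ h, e]
  have key := hf.eventually_abs_mul_deriv_sub_le hk hα hb (hgtop.comp hΛ) (hgtop.comp hyΛ)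
    hlogΛ hs ((hΛ.eventually_gt_atTop r₀).mono fun p h => hg _ h) hTc hδ
  rw [hl, eventually_inf_principal, eventually_comap] at key
  obtain ⟨N, hN⟩ := eventually_atTop.1 key
  exact ⟨max N (r₀ + 1), lt_max_of_lt_right (lt_add_one r₀), fun Λ h y hy =>
    hN Λ ((le_max_left _ _).trans h.le) (Λ, y) rfl hy⟩
end
end

section
/- Let n ∈ ℕ, α > 1, and let g : (Λ₀,∞) → ℝ be defined, for Λ₀ sufficiently large, by letting g(Λ) be the unique sufficiently large solution y of yᵅ + C₁·ln y = C₂ + C₃·ln Λ, where C₁ = (2−(α−2)·n)/(2(α−1)), C₂ = (ln(α−1) + n·ln α − n·ln(2π))/(2(α−1)), C₃ = 1/(α−1). Then lim_{Λ→∞} g(Λ)/(ln Λ)^{1/α} = (α−1)^{−1/α}. -/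
open Filter Real
open scoped Topology

noncomputable section

/-- If `t ≥ 1` solves `t + c log t = a + b u` with `u → ∞` and `b > 0`, then `t / u → b`. -/
theorem tendsto_div_of_add_mul_log_eq {ι : Type*} {l : Filter ι} {t u : ι → ℝ} {a b c : ℝ}
    (hb : 0 < b) (hu : Tendsto u l atTop) (ht : ∀ᶠ i in l, 1 ≤ t i)
    (h : ∀ᶠ i in l, t i + c * Real.log (t i) = a + b * u i) :
    Tendsto (fun i => t i / u i) l (𝓝 b) := by
  have htop : Tendsto t l atTop := by
    have h1 : Tendsto (fun i => (a + b * u i) / (1 + |c|)) l atTop :=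
      (tendsto_atTop_add_const_left l a (hu.const_mul_atTop hb)).atTop_div_const (by positivity)
    refine tendsto_atTop_mono' l ?_ h1
    filter_upwards [ht, h] with i hi hi'
    rw [div_le_iff₀ (by positivity), ← hi']
    have hlog : 0 ≤ Real.log (t i) := Real.log_nonneg hi
    have hle : Real.log (t i) ≤ t i := Real.log_le_self (by linarith)
    have : c * Real.log (t i) ≤ |c| * t i :=
      mul_le_mul (le_abs_self c) hle hlog (abs_nonneg c)
    linarith
  have hlog : Tendsto (fun i => Real.log (t i) / t i) l (𝓝 0) :=
    Real.isLittleO_log_id_atTop.tendsto_div_nhds_zero.comp htop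
  have hinv : Tendsto (fun i => (t i)⁻¹) l (𝓝 0) := tendsto_inv_atTop_zero.comp htop
  have hlim : Tendsto (fun i => b / (1 + c * (Real.log (t i) / t i) - a * (t i)⁻¹)) l (𝓝 b) := by
    have hden := ((hlog.const_mul c).const_add 1).sub (hinv.const_mul a)
    have hquot := (tendsto_const_nhds (x := b)).div hden (by simp)
    rwa [mul_zero, mul_zero, add_zero, sub_zero, div_one] at hquot
  refine hlim.congr' ?_
  filter_upwards [ht, h, hu.eventually_gt_atTop 0] with i hi hi' hui
  have ht0 : t i ≠ 0 := by linarith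
  have hden : 1 + c * (Real.log (t i) / t i) - a * (t i)⁻¹ = b * u i / t i := by
    field_simp
    linarith
  rw [hden]
  field_simp

/-- Equation (1.4): the solution `g` of `y^α + C₁ ln y = C₂ + C₃ ln Λ` satisfies
`g(Λ)/(ln Λ)^{1/α} → (α-1)^{-1/α}`. -/
theorem stmt8 {n : ℕ} (hn : 0 < n) {α : ℝ} (hα : 1 < α)
    (y₀ Λ₀ : ℝ) (hy₀ : 1 ≤ y₀) (hΛ₀ : 0 < Λ₀) (g : ℝ → ℝ)
    (hg : ∀ Λ : ℝ, Λ₀ < Λ → y₀ < g Λ ∧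
      g Λ ^ α + (2 - (α - 2) * n) / (2 * (α - 1)) * Real.log (g Λ)
        = (Real.log (α - 1) + n * Real.log α - n * Real.log (2 * π)) / (2 * (α - 1))
          + 1 / (α - 1) * Real.log Λ)
    (hg_unique : ∀ Λ : ℝ, Λ₀ < Λ → ∀ y : ℝ, y₀ < y →
      y ^ α + (2 - (α - 2) * n) / (2 * (α - 1)) * Real.log y
        = (Real.log (α - 1) + n * Real.log α - n * Real.log (2 * π)) / (2 * (α - 1))
          + 1 / (α - 1) * Real.log Λ → y = g Λ) :
    Filter.Tendsto (fun Λ : ℝ => g Λ / Real.log Λ ^ α⁻¹)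
        Filter.atTop (nhds ((α - 1) ^ (-α⁻¹))) := by
  have hα0 : 0 < α := by linarith
  have hgt : ∀ᶠ Λ in atTop, Λ₀ < Λ := eventually_gt_atTop Λ₀
  have key : Tendsto (fun Λ => g Λ ^ α / Real.log Λ) atTop (𝓝 (1 / (α - 1))) := by
    refine tendsto_div_of_add_mul_log_eq
      (c := (2 - (α - 2) * n) / (2 * (α - 1)) / α)
      (a := (Real.log (α - 1) + n * Real.log α - n * Real.log (2 * π)) / (2 * (α - 1)))
      (one_div_pos.2 (sub_pos.2 hα)) Real.tendsto_log_atTop ?_ ?_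
    · filter_upwards [hgt] with Λ hΛ
      exact Real.one_le_rpow (hy₀.trans (hg Λ hΛ).1.le) hα0.le
    · filter_upwards [hgt] with Λ hΛ
      obtain ⟨h1, h2⟩ := hg Λ hΛ
      rw [← h2, Real.log_rpow (by linarith), ← mul_assoc, div_mul_cancel₀ _ hα0.ne']
  have hroot := key.rpow_const (p := α⁻¹) (Or.inr (inv_nonneg.2 hα0.le))
  rw [one_div, Real.inv_rpow (sub_pos.2 hα).le, ← Real.rpow_neg (sub_pos.2 hα).le] at hroot
  refine hroot.congr' ?_
  filter_upwards [hgt, eventually_ge_atTop 1] with Λ hΛ hΛ1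
  have hg0 : 0 ≤ g Λ := by linarith [(hg Λ hΛ).1]
  rw [Real.div_rpow (Real.rpow_nonneg hg0 α) (Real.log_nonneg hΛ1),
    Real.rpow_rpow_inv hg0 hα0.ne']
end
end
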